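/- arXiv:math/0702510 — 6 statements merged into one kernel-verified Lean document; each statement's English description precedes it below -/
import Mathlib

section
/- Let U be an N×N complex unitary matrix. Then the real dimension of the space S(U) equals the complex dimension of the complex vector space of complex N×N matrices R satisfying, for all 1 ≤ i < j ≤ N, both Σ_{k=1}^N U_{i,k}·conj(U_{j,k})·(R_{i,k} − R_{j,k}) = 0 and Σ_{k=1}^N conj(U_{i,k})·U_{j,k}·(R_{i,k} − R_{j,k}) = 0. Consequently the defect satisfies d(U) = dim_ℂ of that complex solution space minus (2N−1). -/
open Matrix ComplexConjugate

noncomputable section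

/-- The real vector space `S(U)` of real `N×N` matrices `R` such that for all `i < j`,
`∑ k, U i k * conj (U j k) * (R i k - R j k) = 0`. -/
def defectSpace {N : ℕ} (U : Matrix (Fin N) (Fin N) ℂ) :
    Submodule ℝ (Matrix (Fin N) (Fin N) ℝ) where
  carrier := {R | ∀ i j : Fin N, i < j →
    ∑ k, U i k * conj (U j k) * ((R i k : ℂ) - (R j k : ℂ)) = 0}
  zero_mem' := by
    intro i j hij
    simp
  add_mem' := by
    intro R R' hR hR' i j hij
    have h1 := hR i j hij
    have h2 := hR' i j hij
    have key : ∀ k, U i k * conj (U j k) * (((R + R') i k : ℂ) - ((R + R') j k : ℂ))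
        = U i k * conj (U j k) * ((R i k : ℂ) - (R j k : ℂ))
          + U i k * conj (U j k) * ((R' i k : ℂ) - (R' j k : ℂ)) := by
      intro k
      simp only [Matrix.add_apply]
      push_cast
      ring
    rw [Finset.sum_congr rfl fun k _ => key k, Finset.sum_add_distrib, h1, h2, add_zero]
  smul_mem' := by
    intro c R hR i j hij
    have h1 := hR i j hij
    have key : ∀ k, U i k * conj (U j k) * (((c • R) i k : ℂ) - ((c • R) j k : ℂ))
        = (c : ℂ) * (U i k * conj (U j k) * ((R i k : ℂ) - (R j k : ℂ))) := by
      intro k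
      simp only [Matrix.smul_apply, smul_eq_mul]
      push_cast
      ring
    rw [Finset.sum_congr rfl fun k _ => key k, ← Finset.mul_sum, h1, mul_zero]

/-- The defect of a unitary matrix `U`: `d(U) = dim_ℝ S(U) - (2N - 1)`. -/
def defect {N : ℕ} (U : Matrix (Fin N) (Fin N) ℂ) : ℕ :=
  Module.finrank ℝ (defectSpace U) - (2 * N - 1)

/-- The complex vector space of complex `N×N` matrices `R` such that for all `i < j`, both
`∑ k, U i k * conj (U j k) * (R i k - R j k) = 0` and
`∑ k, conj (U i k) * U j k * (R i k - R j k) = 0`. -/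
def defectSpaceC {N : ℕ} (U : Matrix (Fin N) (Fin N) ℂ) :
    Submodule ℂ (Matrix (Fin N) (Fin N) ℂ) where
  carrier := {R | ∀ i j : Fin N, i < j →
    (∑ k, U i k * conj (U j k) * (R i k - R j k) = 0) ∧
    (∑ k, conj (U i k) * U j k * (R i k - R j k) = 0)}
  zero_mem' := by
    intro i j hij
    simp
  add_mem' := by
    intro R R' hR hR' i j hij
    obtain ⟨h1, h1'⟩ := hR i j hij
    obtain ⟨h2, h2'⟩ := hR' i j hij
    constructor
    · have key : ∀ k, U i k * conj (U j k) * ((R + R') i k - (R + R') j k)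
          = U i k * conj (U j k) * (R i k - R j k)
            + U i k * conj (U j k) * (R' i k - R' j k) := by
        intro k
        simp only [Matrix.add_apply]
        ring
      rw [Finset.sum_congr rfl fun k _ => key k, Finset.sum_add_distrib, h1, h2, add_zero]
    · have key : ∀ k, conj (U i k) * U j k * ((R + R') i k - (R + R') j k)
          = conj (U i k) * U j k * (R i k - R j k)
            + conj (U i k) * U j k * (R' i k - R' j k) := by
        intro k
        simp only [Matrix.add_apply]
        ring
      rw [Finset.sum_congr rfl fun k _ => key k, Finset.sum_add_distrib, h1', h2', add_zero]
  smul_mem' := by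
    intro c R hR i j hij
    obtain ⟨h1, h1'⟩ := hR i j hij
    constructor
    · have key : ∀ k, U i k * conj (U j k) * ((c • R) i k - (c • R) j k)
          = c * (U i k * conj (U j k) * (R i k - R j k)) := by
        intro k
        simp only [Matrix.smul_apply, smul_eq_mul]
        ring
      rw [Finset.sum_congr rfl fun k _ => key k, ← Finset.mul_sum, h1, mul_zero]
    · have key : ∀ k, conj (U i k) * U j k * ((c • R) i k - (c • R) j k)
          = c * (conj (U i k) * U j k * (R i k - R j k)) := by
        intro k
        simp only [Matrix.smul_apply, smul_eq_mul]
        ring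
      rw [Finset.sum_congr rfl fun k _ => key k, ← Finset.mul_sum, h1', mul_zero]

/-- A complex matrix solves the complexified system iff its real and imaginary parts both lie in
`S(U)`. -/
theorem mem_defectSpaceC_iff {N : ℕ} (U R : Matrix (Fin N) (Fin N) ℂ) :
    R ∈ defectSpaceC U ↔ R.map Complex.re ∈ defectSpace U ∧ R.map Complex.im ∈ defectSpace U := by
  have conj_sum (S : Matrix (Fin N) (Fin N) ℂ) (i j : Fin N) :
      conj (∑ k, conj (U i k) * U j k * (S i k - S j k)) =
        ∑ k, U i k * conj (U j k) * (conj (S i k) - conj (S j k)) := by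
    simp
  constructor
  · intro hR
    constructor
    · intro i j hij
      obtain ⟨h1, h2⟩ := hR i j hij
      have h3 := conj_sum R i j
      rw [h2, map_zero] at h3
      calc
        _ = (1 / 2 : ℂ) * (∑ k, U i k * conj (U j k) * (R i k - R j k) +
            ∑ k, U i k * conj (U j k) * (conj (R i k) - conj (R j k))) := by
          rw [← Finset.sum_add_distrib, Finset.mul_sum]
          refine Finset.sum_congr rfl fun k _ => ?_
          simp only [map_apply, Complex.re_eq_add_conj]
          ring
        _ = 0 := by rw [h1, ← h3]; simp
    · intro i j hij
      obtain ⟨h1, h2⟩ := hR i j hij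
      have h3 := conj_sum R i j
      rw [h2, map_zero] at h3
      calc
        _ = (1 / (2 * Complex.I) : ℂ) * (∑ k, U i k * conj (U j k) * (R i k - R j k) -
            ∑ k, U i k * conj (U j k) * (conj (R i k) - conj (R j k))) := by
          rw [← Finset.sum_sub_distrib, Finset.mul_sum]
          refine Finset.sum_congr rfl fun k _ => ?_
          simp only [map_apply, Complex.im_eq_sub_conj]
          ring
        _ = 0 := by rw [h1, ← h3]; simp
  · rintro ⟨hre, him⟩ i j hij
    have h1 := hre i j hij
    have h2 := him i j hij
    simp only [map_apply] at h1 h2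
    constructor
    · calc
        _ = ∑ k, U i k * conj (U j k) * (((R i k).re : ℂ) - ((R j k).re : ℂ)) +
            Complex.I * ∑ k, U i k * conj (U j k) * (((R i k).im : ℂ) - ((R j k).im : ℂ)) := by
          rw [Finset.mul_sum, ← Finset.sum_add_distrib]
          refine Finset.sum_congr rfl fun k _ => ?_
          conv_lhs => rw [← Complex.re_add_im (R i k), ← Complex.re_add_im (R j k)]
          ring
        _ = 0 := by rw [h1, h2]; simp
    · apply (starRingEnd ℂ).injective
      rw [conj_sum, map_zero]
      calc
        _ = ∑ k, U i k * conj (U j k) * (((R i k).re : ℂ) - ((R j k).re : ℂ)) -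
            Complex.I * ∑ k, U i k * conj (U j k) * (((R i k).im : ℂ) - ((R j k).im : ℂ)) := by
          rw [Finset.mul_sum, ← Finset.sum_sub_distrib]
          refine Finset.sum_congr rfl fun k _ => ?_
          have conj_eq (z : ℂ) : conj z = z.re - z.im * Complex.I := by
            apply Complex.ext <;> simp
          rw [conj_eq (R i k), conj_eq (R j k)]
          ring
        _ = 0 := by rw [h1, h2]; simp

/-- The complex solution space is, over `ℝ`, the sum of two copies of `S(U)`. -/
def defectSpaceCEquivProd {N : ℕ} (U : Matrix (Fin N) (Fin N) ℂ) :
    defectSpaceC U ≃ₗ[ℝ] defectSpace U × defectSpace U where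
  toFun R := (⟨R.1.map Complex.re, ((mem_defectSpaceC_iff U R.1).1 R.2).1⟩,
    ⟨R.1.map Complex.im, ((mem_defectSpaceC_iff U R.1).1 R.2).2⟩)
  invFun p := ⟨of fun i j => ⟨p.1.1 i j, p.2.1 i j⟩,
    (mem_defectSpaceC_iff U _).2 ⟨p.1.2, p.2.2⟩⟩
  map_add' R R' := by ext <;> simp
  map_smul' c R := by ext <;> simp
  left_inv R := by ext; simp
  right_inv p := by ext <;> simp

theorem finrank_defectSpace {N : ℕ} (U : Matrix (Fin N) (Fin N) ℂ) :
    Module.finrank ℝ (defectSpace U) = Module.finrank ℂ (defectSpaceC U) := by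
  have h := (defectSpaceCEquivProd U).finrank_eq
  have h' := finrank_real_of_complex (defectSpaceC U)
  rw [Module.finrank_prod] at h
  lia

/-- The real dimension of `S(U)` equals the complex dimension of the complex solution space,
and consequently `d(U)` equals that complex dimension minus `(2N - 1)`. -/
theorem defect_eq_complex_solution_space_dim {N : ℕ} (U : Matrix (Fin N) (Fin N) ℂ)
    (hU : U ∈ Matrix.unitaryGroup (Fin N) ℂ) :
    Module.finrank ℝ (defectSpace U) = Module.finrank ℂ (defectSpaceC U) ∧
    defect U = Module.finrank ℂ (defectSpaceC U) - (2 * N - 1) := by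
  exact ⟨finrank_defectSpace U, by rw [defect, finrank_defectSpace]⟩

end
end

section
/- Let U be an N×N complex unitary matrix and let P_r and P_c be N×N permutation matrices. Then d(P_r · U · P_c) = d(U). -/
open Matrix ComplexConjugate

noncomputable section

/-- Membership in `defectSpace U`, with the condition stated for all pairs of rows. -/
theorem mem_defectSpace_iff_forall {N : ℕ} (U : Matrix (Fin N) (Fin N) ℂ)
    (R : Matrix (Fin N) (Fin N) ℝ) :
    R ∈ defectSpace U ↔
      ∀ i j, ∑ k, U i k * conj (U j k) * ((R i k : ℂ) - (R j k : ℂ)) = 0 := by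
  refine ⟨fun h i j => ?_, fun h i j _ => h i j⟩
  rcases lt_trichotomy i j with hij | rfl | hij
  · exact h i j hij
  · simp
  · have hconj := congrArg (fun z => -conj z) (h j i hij)
    simp only [map_sum, map_mul, map_sub, Complex.conj_conj, Complex.conj_ofReal, map_zero,
      neg_zero, ← Finset.sum_neg_distrib] at hconj
    rw [← hconj]
    exact Finset.sum_congr rfl fun k _ => by ring

/-- Permuting rows and columns of both matrices preserves membership in `defectSpace`. -/
theorem submatrix_mem_defectSpace_submatrix_iff {N : ℕ} (U : Matrix (Fin N) (Fin N) ℂ)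
    (σ τ : Equiv.Perm (Fin N)) (R : Matrix (Fin N) (Fin N) ℝ) :
    R.submatrix σ τ ∈ defectSpace (U.submatrix σ τ) ↔ R ∈ defectSpace U := by
  simp only [mem_defectSpace_iff_forall, submatrix_apply]
  have hsum (i j : Fin N) := Equiv.sum_comp τ
    fun k => U i k * conj (U j k) * ((R i k : ℂ) - (R j k : ℂ))
  simp only [hsum]
  exact ⟨fun h i j => by simpa using h (σ.symm i) (σ.symm j), fun h i j => h _ _⟩

theorem defect_submatrix {N : ℕ} (U : Matrix (Fin N) (Fin N) ℂ) (σ τ : Equiv.Perm (Fin N)) :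
    defect (U.submatrix σ τ) = defect U := by
  let e := reindexLinearEquiv ℝ ℝ σ.symm τ.symm
  have hmap : defectSpace U = (defectSpace (U.submatrix σ τ)).comap e.toLinearMap := by
    ext R
    exact (submatrix_mem_defectSpace_submatrix_iff U σ τ R).symm
  have hfin : Module.finrank ℝ (defectSpace U)
      = Module.finrank ℝ (defectSpace (U.submatrix σ τ)) := by
    rw [hmap]
    exact (e.ofSubmodule' _).finrank_eq
  rw [defect, defect, hfin]

/-- The defect is invariant under left and right multiplication by permutation matrices. -/
theorem defect_perm_invariant {N : ℕ} (U : Matrix (Fin N) (Fin N) ℂ)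
    (hU : U ∈ Matrix.unitaryGroup (Fin N) ℂ)
    (Pr Pc : Matrix (Fin N) (Fin N) ℂ)
    (hPr : ∃ σ : Equiv.Perm (Fin N), ∀ i j, Pr i j = if σ i = j then 1 else 0)
    (hPc : ∃ σ : Equiv.Perm (Fin N), ∀ i j, Pc i j = if σ i = j then 1 else 0) :
    defect (Pr * U * Pc) = defect U := by
  obtain ⟨σ, hσ⟩ := hPr
  obtain ⟨τ, hτ⟩ := hPc
  have hmul : Pr * U * Pc = U.submatrix σ τ.symm := by
    ext i j
    have hrow (k : Fin N) : (Pr * U) i k = U (σ i) k := by simp [mul_apply, hσ]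
    simp [mul_apply (M := Pr * U), hrow, hτ, ← Equiv.eq_symm_apply]
  rw [hmul, defect_submatrix]

end
end

section
/- Let U be an N×N complex unitary matrix. Then d(U) = d(Uᵀ) = d(U*) = d(conj(U)), where Uᵀ is the transpose, U* the conjugate transpose, and conj(U) the entrywise complex conjugate of U. -/
open Matrix ComplexConjugate

noncomputable section

/-- A real matrix `R` lies in `S(U)` iff `(U ∘ R) U*` is Hermitian, where `∘` is the entrywise
product. -/
theorem mem_defectSpace_iff_isHermitian {N : ℕ} (U : Matrix (Fin N) (Fin N) ℂ)
    (R : Matrix (Fin N) (Fin N) ℝ) :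
    R ∈ defectSpace U ↔ ((U ⊙ R.map Complex.ofReal) * Uᴴ).IsHermitian := by
  have entry : ∀ i j, ((U ⊙ R.map Complex.ofReal) * Uᴴ) i j
      - star (((U ⊙ R.map Complex.ofReal) * Uᴴ) j i)
      = ∑ k, U i k * conj (U j k) * ((R i k : ℂ) - (R j k : ℂ)) := by
    intro i j
    simp only [mul_apply, hadamard_apply, map_apply, conjTranspose_apply, star_sum,
      ← Finset.sum_sub_distrib]
    refine Finset.sum_congr rfl fun k _ => ?_
    simp only [Complex.star_def, map_mul, Complex.conj_ofReal, Complex.conj_conj]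
    ring
  constructor
  · intro hR
    refine IsHermitian.ext fun i j => ?_
    rcases lt_trichotomy i j with hij | rfl | hij
    · exact (sub_eq_zero.mp ((entry i j).trans (hR i j hij))).symm
    · refine (sub_eq_zero.mp ((entry i i).trans ?_)).symm
      simp
    · rw [sub_eq_zero.mp ((entry j i).trans (hR j i hij)), star_star]
  · intro hH i j _
    rw [← entry i j, hH.apply, sub_self]

theorem transpose_mem_defectSpace_conjTranspose {N : ℕ} {U : Matrix (Fin N) (Fin N) ℂ}
    (hU : U ∈ Matrix.unitaryGroup (Fin N) ℂ) {R : Matrix (Fin N) (Fin N) ℝ}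
    (hR : R ∈ defectSpace U) : Rᵀ ∈ defectSpace Uᴴ := by
  rw [mem_defectSpace_iff_isHermitian] at hR ⊢
  have hUU : Uᴴ * U = 1 := mem_unitaryGroup_iff'.mp hU
  have hadamard_conjTranspose :
      Uᴴ ⊙ Rᵀ.map Complex.ofReal = (U ⊙ R.map Complex.ofReal)ᴴ := by
    ext i j
    simp
  have conjugate : (Uᴴ ⊙ Rᵀ.map Complex.ofReal) * Uᴴᴴ
      = Uᴴ * ((U ⊙ R.map Complex.ofReal) * Uᴴ) * U := by
    rw [← hR.eq, conjTranspose_mul, conjTranspose_conjTranspose, ← Matrix.mul_assoc, hUU,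
      Matrix.one_mul, hadamard_conjTranspose]
  rw [conjugate]
  exact isHermitian_conjTranspose_mul_mul U hR

theorem defect_conjTranspose {N : ℕ} {U : Matrix (Fin N) (Fin N) ℂ}
    (hU : U ∈ Matrix.unitaryGroup (Fin N) ℂ) : defect Uᴴ = defect U := by
  have map_eq : (defectSpace U).map
      (transposeLinearEquiv (Fin N) (Fin N) ℝ ℝ).toLinearMap = defectSpace Uᴴ := by
    ext R
    constructor
    · rintro ⟨R, hR, rfl⟩
      exact transpose_mem_defectSpace_conjTranspose hU hR
    · intro hR
      refine ⟨Rᵀ, ?_, transpose_transpose R⟩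
      rw [← conjTranspose_conjTranspose U]
      exact transpose_mem_defectSpace_conjTranspose (Unitary.star_mem hU) hR
  rw [defect, defect, ← map_eq, LinearEquiv.finrank_map_eq]

theorem defectSpace_map_conj {N : ℕ} (U : Matrix (Fin N) (Fin N) ℂ) :
    defectSpace (U.map (starRingEnd ℂ)) = defectSpace U := by
  ext R
  refine forall₃_congr fun i j _ => ?_
  rw [← map_eq_zero (starRingEnd ℂ)]
  simp

theorem defect_map_conj {N : ℕ} (U : Matrix (Fin N) (Fin N) ℂ) :
    defect (U.map (starRingEnd ℂ)) = defect U := by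
  rw [defect, defect, defectSpace_map_conj]

/-- `d(U) = d(Uᵀ) = d(U*) = d(conj U)`. -/
theorem defect_transpose_conjTranspose_conj {N : ℕ} (U : Matrix (Fin N) (Fin N) ℂ)
    (hU : U ∈ Matrix.unitaryGroup (Fin N) ℂ) :
    defect U = defect Uᵀ ∧ defect U = defect Uᴴ ∧
    defect U = defect (U.map (starRingEnd ℂ)) := by
  have hT : defect Uᵀ = defect U :=
    (defect_map_conj Uᵀ).symm.trans (defect_conjTranspose hU)
  exact ⟨hT.symm, (defect_conjTranspose hU).symm, (defect_map_conj U).symm⟩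

end
end

section
/- Let Q be an N×N real orthogonal matrix, regarded as a complex unitary matrix with real entries. Then d(Q) ≥ (N−1)(N−2)/2. -/
open Matrix ComplexConjugate

noncomputable section

/-- The defining equations of `defectSpace` for a real matrix `Q`, indexed by the pairs `i < j`. -/
def defectEquations {N : ℕ} (Q : Matrix (Fin N) (Fin N) ℝ) :
    Matrix (Fin N) (Fin N) ℝ →ₗ[ℝ] ((Σ j : Fin N, Fin j) → ℝ) where
  toFun R p := ∑ k, Q (p.2.castLE p.1.2.le) k * Q p.1 k * (R (p.2.castLE p.1.2.le) k - R p.1 k)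
  map_add' R R' := by
    ext p
    simp only [Matrix.add_apply, Pi.add_apply, ← Finset.sum_add_distrib]
    exact Finset.sum_congr rfl fun k _ => by ring
  map_smul' c R := by
    ext p
    simp only [Matrix.smul_apply, Pi.smul_apply, smul_eq_mul, RingHom.id_apply, Finset.mul_sum]
    exact Finset.sum_congr rfl fun k _ => by ring

theorem ker_defectEquations_le {N : ℕ} (Q : Matrix (Fin N) (Fin N) ℝ) :
    LinearMap.ker (defectEquations Q) ≤ defectSpace (Q.map Complex.ofReal) := by
  intro R hR i j hij
  have h : ∑ k, Q i k * Q j k * (R i k - R j k) = 0 := congrFun hR ⟨j, ⟨i, hij⟩⟩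
  simp only [Matrix.map_apply, Complex.conj_ofReal]
  exact_mod_cast h

theorem card_sigma_fin_mul_two (N : ℕ) :
    Fintype.card (Σ j : Fin N, Fin j) * 2 = N * (N - 1) := by
  simp only [Fintype.card_sigma, Fintype.card_fin]
  rw [Fin.sum_univ_eq_sum_range (fun i => i) N, Finset.sum_range_id_mul_two]

/-- Counting equations: `dim S(Q) ≥ N² - N(N-1)/2` for every real matrix `Q`. -/
theorem mul_add_one_le_two_mul_finrank_defectSpace {N : ℕ} (Q : Matrix (Fin N) (Fin N) ℝ) :
    N * (N + 1) ≤ 2 * Module.finrank ℝ (defectSpace (Q.map Complex.ofReal)) := by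
  have hker := Submodule.finrank_mono (ker_defectEquations_le Q)
  have hrange := Submodule.finrank_le (LinearMap.range (defectEquations Q))
  have hsum := LinearMap.finrank_range_add_finrank_ker (defectEquations Q)
  have hcard := card_sigma_fin_mul_two N
  rw [Module.finrank_fintype_fun_eq_card] at hrange
  rw [Module.finrank_matrix, Module.finrank_self, Fintype.card_fin, mul_one] at hsum
  cases N with
  | zero => simp
  | succ n =>
    rw [Nat.add_sub_cancel] at hcard
    nlinarith

/-- A real orthogonal matrix, regarded as a complex unitary matrix, has defect at least
`(N-1)(N-2)/2`. -/
theorem defect_orthogonal_lower_bound {N : ℕ} (Q : Matrix (Fin N) (Fin N) ℝ)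
    (hQ : Q ∈ Matrix.orthogonalGroup (Fin N) ℝ) :
    (N - 1) * (N - 2) / 2 ≤ defect (Q.map Complex.ofReal) := by
  have h := mul_add_one_le_two_mul_finrank_defectSpace Q
  unfold defect
  match N with
  | 0 => simp
  | 1 => simp
  | n + 2 =>
    have hn : (n + 2 - 1) * (n + 2 - 2) = (n + 1) * n := rfl
    rw [hn]
    have hexp : (n + 2) * (n + 2 + 1) = (n + 1) * n + 4 * n + 6 := by ring
    omega

end
end

section
/- Let N ≥ 2 be a natural number with prime factorization N = Π_{j=1}^n p_j^{k_j} (p_1, …, p_n distinct primes, k_j ≥ 1). Then, as an identity of rational numbers, d(F_N) = N·(Π_{j=1}^n (1 + k_j − k_j/p_j) − 2) + 1. -/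
open Matrix ComplexConjugate

noncomputable section

/-- The Fourier matrix `F_N`, with entries `exp(2πi(i-1)(j-1)/N)/√N` (0-based indexing). -/
def fourierMatrix (N : ℕ) : Matrix (Fin N) (Fin N) ℂ :=
  Matrix.of fun i j : Fin N =>
    Complex.exp (2 * Real.pi * Complex.I * (i : ℕ) * (j : ℕ) / N) / (Real.sqrt N : ℝ)

/-- The discrete Hartley transform on `ZMod N`: the sum of the real and imaginary parts of the
discrete Fourier transform of a real function. -/
def hartley (N : ℕ) [NeZero N] : (ZMod N → ℝ) →ₗ[ℝ] (ZMod N → ℝ) where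
  toFun r m := (ZMod.dft (fun j => (r j : ℂ)) m).re + (ZMod.dft (fun j => (r j : ℂ)) m).im
  map_add' r s := by
    ext m
    have h : (fun j => ((r + s) j : ℂ)) = (fun j => (r j : ℂ)) + fun j => (s j : ℂ) := by
      ext j; simp
    rw [h, map_add]
    simp only [Pi.add_apply, Complex.add_re, Complex.add_im]
    ring
  map_smul' c r := by
    ext m
    have h : (fun j => ((c • r) j : ℂ)) = (c : ℂ) • fun j => (r j : ℂ) := by
      ext j; simp
    rw [h, map_smul]
    simp only [Pi.smul_apply, smul_eq_mul, Complex.re_ofReal_mul, Complex.im_ofReal_mul,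
      RingHom.id_apply]
    ring

lemma dft_ofReal_neg {N : ℕ} [NeZero N] (r : ZMod N → ℝ) (m : ZMod N) :
    ZMod.dft (fun j => (r j : ℂ)) (-m) = conj (ZMod.dft (fun j => (r j : ℂ)) m) := by
  simp [ZMod.dft_apply, map_sum, ← AddChar.map_neg_eq_conj]

lemma hartley_neg_apply {N : ℕ} [NeZero N] (r : ZMod N → ℝ) (m : ZMod N) :
    hartley N r (-m) =
      (ZMod.dft (fun j => (r j : ℂ)) m).re - (ZMod.dft (fun j => (r j : ℂ)) m).im := by
  simp [hartley, dft_ofReal_neg, sub_eq_add_neg]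

lemma dft_ofReal_eq_iff {N : ℕ} [NeZero N] (r s : ZMod N → ℝ) (m : ZMod N) :
    ZMod.dft (fun j => (r j : ℂ)) m = ZMod.dft (fun j => (s j : ℂ)) m ↔
      hartley N r m = hartley N s m ∧ hartley N r (-m) = hartley N s (-m) := by
  rw [hartley_neg_apply, hartley_neg_apply, Complex.ext_iff]
  simp only [hartley, LinearMap.coe_mk, AddHom.coe_mk]
  constructor
  · rintro ⟨h, h'⟩
    simp [h, h']
  · rintro ⟨h, h'⟩
    constructor <;> linarith

lemma hartley_injective (N : ℕ) [NeZero N] : Function.Injective (hartley N) := by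
  intro r s h
  have h' : ZMod.dft (fun j => (r j : ℂ)) = ZMod.dft (fun j => (s j : ℂ)) := by
    ext m
    exact (dft_ofReal_eq_iff r s m).2 (by simp [h])
  ext j
  exact_mod_cast congrFun (ZMod.dft.injective h') j

/-- The functions `H` on `ZMod N × ZMod N` such that `H · m` is invariant under translation
by `m`, for all `m`. -/
def translationInvariant (N : ℕ) : Submodule ℝ (ZMod N → ZMod N → ℝ) where
  carrier := {H | ∀ a m, H (a + m) m = H a m}
  zero_mem' := by simp
  add_mem' := by
    intro H K hH hK a m
    simp [hH a m, hK a m]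
  smul_mem' := by
    intro c H hH a m
    simp [hH a m]

lemma index_zmultiples (N : ℕ) [NeZero N] (m : ZMod N) :
    (AddSubgroup.zmultiples m).index = N.gcd m.val := by
  have h := (AddSubgroup.zmultiples m).card_mul_index
  have hm : addOrderOf m = N / N.gcd m.val := by
    rw [← ZMod.addOrderOf_coe _ (NeZero.ne N), ZMod.natCast_zmod_val]
  have hd := Nat.div_mul_cancel (Nat.gcd_dvd_left N m.val)
  rw [Nat.card_zmultiples, Nat.card_zmod, hm] at h
  refine Nat.eq_of_mul_eq_mul_left (Nat.pos_of_ne_zero fun h0 => NeZero.ne N ?_)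
    (h.trans hd.symm)
  rw [← hd, h0, zero_mul]

lemma finrank_translationInvariant (N : ℕ) [NeZero N] :
    Module.finrank ℝ (translationInvariant N) = ∑ m ∈ Finset.range N, N.gcd m := by
  classical
  let L : ((Σ m : ZMod N, ZMod N ⧸ AddSubgroup.zmultiples m) → ℝ) →ₗ[ℝ]
      (ZMod N → ZMod N → ℝ) :=
    { toFun := fun g a m => g ⟨m, (a : ZMod N ⧸ AddSubgroup.zmultiples m)⟩
      map_add' := fun _ _ => rfl
      map_smul' := fun _ _ => rfl }
  have hL : Function.Injective L := by
    intro g g' h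
    ext ⟨m, q⟩
    induction q using QuotientAddGroup.induction_on with
    | H a => exact congrFun (congrFun h a) m
  have hrange : LinearMap.range L = translationInvariant N := by
    ext H
    constructor
    · rintro ⟨g, rfl⟩ a m
      have h : ((a + m : ZMod N) : ZMod N ⧸ AddSubgroup.zmultiples m) = a := by
        rw [QuotientAddGroup.eq]
        simp
      simp [L, h]
    · intro hH
      have hz (m a : ZMod N) (z : ℤ) : H (a + z • m) m = H a m := by
        induction z using Int.induction_on with
        | zero => simp
        | succ i ih => rw [add_zsmul, one_zsmul, ← add_assoc, hH, ih]
        | pred i ih => rw [← ih, ← hH, add_assoc, sub_zsmul, one_zsmul, neg_add_cancel_right]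
      refine ⟨fun x => H x.2.out x.1, ?_⟩
      ext a m
      obtain ⟨⟨_, z, rfl⟩, h⟩ := QuotientAddGroup.mk_out_eq_add (AddSubgroup.zmultiples m) a
      simpa [L, h] using hz m a z
  have hcard (m : ZMod N) :
      Fintype.card (ZMod N ⧸ AddSubgroup.zmultiples m) = N.gcd m.val := by
    rw [← index_zmultiples, AddSubgroup.index, Nat.card_eq_fintype_card]
  rw [← hrange, LinearMap.finrank_range_of_inj hL, Module.finrank_fintype_fun_eq_card,
    Fintype.card_sigma, Finset.sum_congr rfl fun m _ => hcard m]
  refine Finset.sum_nbij' ZMod.val (fun m => (m : ZMod N)) ?_ ?_ ?_ ?_ ?_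
  · simp [ZMod.val_lt]
  · simp
  · simp
  · intro m hm
    exact ZMod.val_cast_of_lt (Finset.mem_range.1 hm)
  · simp

/-- The identification of `Fin N` with `ZMod N`. -/
def finZMod (N : ℕ) [NeZero N] : Fin N ≃ ZMod N where
  toFun i := (i : ℕ)
  invFun a := ⟨a.val, ZMod.val_lt a⟩
  left_inv i := Fin.ext (ZMod.val_cast_of_lt i.2)
  right_inv a := ZMod.natCast_zmod_val a

lemma fourierMatrix_apply {N : ℕ} [NeZero N] (i j : Fin N) :
    fourierMatrix N i j =
      ZMod.stdAddChar (finZMod N i * finZMod N j) / (Real.sqrt N : ℝ) := by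
  have h : finZMod N i * finZMod N j = (((i : ℕ) * (j : ℕ) : ℤ) : ZMod N) := by
    simp [finZMod]
  rw [h, ZMod.stdAddChar_coe, fourierMatrix, Matrix.of_apply]
  push_cast
  congr 3
  ring

lemma fourierMatrix_mul_conj {N : ℕ} [NeZero N] (i j k : Fin N) :
    fourierMatrix N i k * conj (fourierMatrix N j k) =
      (N : ℂ)⁻¹ * ZMod.stdAddChar (-(finZMod N k * (finZMod N j - finZMod N i))) := by
  have hN : ((Real.sqrt N : ℝ) : ℂ) * (Real.sqrt N : ℝ) = N := by
    rw [← Complex.ofReal_mul, Real.mul_self_sqrt (Nat.cast_nonneg N), Complex.ofReal_natCast]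
  rw [fourierMatrix_apply, fourierMatrix_apply, map_div₀, Complex.conj_ofReal,
    ← AddChar.map_neg_eq_conj, div_mul_div_comm, hN, ← AddChar.map_add_eq_mul, div_eq_inv_mul]
  congr 2
  ring

/-- Apply the Hartley transform to each row of a real matrix. -/
def rowHartley (N : ℕ) [NeZero N] :
    Matrix (Fin N) (Fin N) ℝ ≃ₗ[ℝ] (ZMod N → ZMod N → ℝ) :=
  (Matrix.reindexLinearEquiv ℝ ℝ (finZMod N) (finZMod N)).trans
    (LinearEquiv.piCongrRight fun _ =>
      LinearEquiv.ofInjectiveEndo (hartley N) (hartley_injective N))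

lemma rowHartley_apply {N : ℕ} [NeZero N] (R : Matrix (Fin N) (Fin N) ℝ) (i : Fin N) :
    rowHartley N R (finZMod N i) = hartley N fun k => R i ((finZMod N).symm k) := by
  change hartley N (fun k => R ((finZMod N).symm (finZMod N i)) ((finZMod N).symm k)) = _
  rw [Equiv.symm_apply_apply]

lemma sum_fourierMatrix_eq_zero_iff {N : ℕ} [NeZero N] (R : Matrix (Fin N) (Fin N) ℝ)
    (i j : Fin N) :
    ∑ k, fourierMatrix N i k * conj (fourierMatrix N j k) * ((R i k : ℂ) - (R j k : ℂ)) = 0 ↔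
      ZMod.dft (fun k => (R i ((finZMod N).symm k) : ℂ)) (finZMod N j - finZMod N i) =
        ZMod.dft (fun k => (R j ((finZMod N).symm k) : ℂ)) (finZMod N j - finZMod N i) := by
  have h : ∑ k, fourierMatrix N i k * conj (fourierMatrix N j k) *
        ((R i k : ℂ) - (R j k : ℂ)) =
      (N : ℂ)⁻¹ *
        (ZMod.dft (fun k => (R i ((finZMod N).symm k) : ℂ)) (finZMod N j - finZMod N i) -
        ZMod.dft (fun k => (R j ((finZMod N).symm k) : ℂ)) (finZMod N j - finZMod N i)) := by
    rw [ZMod.dft_apply, ZMod.dft_apply, ← Finset.sum_sub_distrib, Finset.mul_sum,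
      ← Equiv.sum_comp (finZMod N)]
    refine Finset.sum_congr rfl fun k _ => ?_
    rw [fourierMatrix_mul_conj, Equiv.symm_apply_apply]
    simp only [smul_eq_mul]
    ring
  rw [h, mul_eq_zero, or_iff_right (inv_ne_zero (Nat.cast_ne_zero.2 (NeZero.ne N))), sub_eq_zero]

lemma mem_defectSpace_fourierMatrix {N : ℕ} [NeZero N] (R : Matrix (Fin N) (Fin N) ℝ) :
    R ∈ defectSpace (fourierMatrix N) ↔ rowHartley N R ∈ translationInvariant N := by
  have hrow (i j : Fin N) :
      ∑ k, fourierMatrix N i k * conj (fourierMatrix N j k) * ((R i k : ℂ) - (R j k : ℂ)) = 0 ↔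
        rowHartley N R (finZMod N i) (finZMod N j - finZMod N i) =
            rowHartley N R (finZMod N j) (finZMod N j - finZMod N i) ∧
          rowHartley N R (finZMod N i) (finZMod N i - finZMod N j) =
            rowHartley N R (finZMod N j) (finZMod N i - finZMod N j) := by
    rw [sum_fourierMatrix_eq_zero_iff, rowHartley_apply, rowHartley_apply,
      ← neg_sub (finZMod N j) (finZMod N i)]
    exact dft_ofReal_eq_iff (fun k => R i ((finZMod N).symm k))
      (fun k => R j ((finZMod N).symm k)) _
  constructor
  · intro hR a m
    obtain ⟨i, rfl⟩ := (finZMod N).surjective a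
    obtain ⟨j, hj⟩ := (finZMod N).surjective (finZMod N i + m)
    obtain rfl : m = finZMod N j - finZMod N i := by rw [hj]; ring
    rw [← hj]
    rcases lt_trichotomy i j with hij | rfl | hij
    · exact ((hrow i j).1 (hR i j hij)).1.symm
    · rfl
    · exact ((hrow j i).1 (hR j i hij)).2
  · intro hR i j _
    refine (hrow i j).2 ⟨?_, ?_⟩
    · simpa using (hR (finZMod N i) (finZMod N j - finZMod N i)).symm
    · simpa using hR (finZMod N j) (finZMod N i - finZMod N j)

lemma finrank_defectSpace_fourierMatrix (N : ℕ) [NeZero N] :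
    Module.finrank ℝ (defectSpace (fourierMatrix N)) = ∑ m ∈ Finset.range N, N.gcd m := by
  have h : defectSpace (fourierMatrix N) =
      (translationInvariant N).comap (rowHartley N : _ →ₗ[ℝ] ZMod N → ZMod N → ℝ) := by
    ext R
    exact mem_defectSpace_fourierMatrix R
  rw [h, ← finrank_translationInvariant]
  exact ((rowHartley N).ofSubmodule' (translationInvariant N)).finrank_eq

/-- Euler's totient as an arithmetic function. -/
def totientFunction : ArithmeticFunction ℕ := ⟨Nat.totient, Nat.totient_zero⟩

lemma isMultiplicative_totientFunction : totientFunction.IsMultiplicative :=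
  ⟨Nat.totient_one, fun h => Nat.totient_mul h⟩

lemma sum_gcd_eq (N : ℕ) [NeZero N] :
    ∑ m ∈ Finset.range N, N.gcd m = (ArithmeticFunction.id * totientFunction) N := by
  rw [ArithmeticFunction.mul_apply,
    Nat.sum_divisorsAntidiagonal (fun a b => ArithmeticFunction.id a * totientFunction b),
    ← Finset.sum_fiberwise_of_maps_to (t := N.divisors) (g := fun m => N.gcd m)
      (fun m _ => Nat.mem_divisors.2 ⟨Nat.gcd_dvd_left N m, NeZero.ne N⟩)]
  refine Finset.sum_congr rfl fun d hd => ?_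
  rw [Finset.sum_congr rfl fun m hm => (Finset.mem_filter.1 hm).2, Finset.sum_const,
    ← Nat.totient_div_of_dvd (Nat.dvd_of_mem_divisors hd), smul_eq_mul, mul_comm]
  rfl

lemma id_mul_totientFunction_prime_pow {p : ℕ} (hp : p.Prime) (k : ℕ) :
    (((ArithmeticFunction.id * totientFunction) (p ^ k) : ℕ) : ℚ) =
      (p : ℚ) ^ k * (1 + k - k / p) := by
  have hp0 : (p : ℚ) ≠ 0 := Nat.cast_ne_zero.2 hp.ne_zero
  rw [ArithmeticFunction.mul_apply, Nat.sum_divisorsAntidiagonal'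
      (fun a b => ArithmeticFunction.id a * totientFunction b),
    Nat.sum_divisors_prime_pow hp, Finset.sum_range_succ']
  have hterm (i : ℕ) (hi : i ∈ Finset.range k) :
      ((ArithmeticFunction.id (p ^ k / p ^ (i + 1)) * totientFunction (p ^ (i + 1)) : ℕ) : ℚ) =
        (p : ℚ) ^ k * (1 - 1 / p) := by
    have hik : i + 1 ≤ k := Finset.mem_range.1 hi
    rw [Nat.pow_div hik hp.pos]
    change ((p ^ (k - (i + 1)) * Nat.totient (p ^ (i + 1)) : ℕ) : ℚ) = _
    rw [Nat.totient_prime_pow_succ hp]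
    obtain ⟨c, rfl⟩ := Nat.exists_eq_add_of_le hik
    rw [Nat.add_sub_cancel_left]
    push_cast [Nat.cast_sub hp.one_le]
    field_simp
    ring
  rw [Nat.cast_add, Nat.cast_sum, Finset.sum_congr rfl hterm]
  simp [totientFunction]
  field_simp
  ring

lemma two_mul_sub_one_le_sum_gcd (N : ℕ) [NeZero N] :
    2 * N - 1 ≤ ∑ m ∈ Finset.range N, N.gcd m := by
  obtain ⟨M, rfl⟩ := Nat.exists_eq_succ_of_ne_zero (NeZero.ne N)
  rw [Finset.sum_range_succ']
  have h : ∑ m ∈ Finset.range M, 1 ≤ ∑ m ∈ Finset.range M, (M + 1).gcd (m + 1) :=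
    Finset.sum_le_sum fun m _ => Nat.gcd_pos_of_pos_left _ M.succ_pos
  simp only [Finset.sum_const, Finset.card_range, smul_eq_mul, mul_one] at h
  simp only [Nat.succ_eq_add_one, Nat.gcd_zero_right]
  omega

/-- If `N = ∏ pⱼ^kⱼ` with `p₁, …, pₙ` distinct primes and `kⱼ ≥ 1`, then as rational numbers
`d(F_N) = N·(∏ (1 + kⱼ - kⱼ/pⱼ) - 2) + 1`. -/
theorem defect_fourier_prime_factorization (N n : ℕ) (hN : 2 ≤ N)
    (p k : Fin n → ℕ) (hp : ∀ j, (p j).Prime) (hdist : Function.Injective p)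
    (hk : ∀ j, 1 ≤ k j) (hfact : N = ∏ j, p j ^ k j) :
    (defect (fourierMatrix N) : ℚ) =
      (N : ℚ) * ((∏ j, (1 + (k j : ℚ) - (k j : ℚ) / (p j : ℚ))) - 2) + 1 := by
  have : NeZero N := ⟨by omega⟩
  have hdim : (∑ m ∈ Finset.range N, N.gcd m : ℕ) =
      (N : ℚ) * ∏ j, (1 + (k j : ℚ) - (k j : ℚ) / (p j : ℚ)) := by
    rw [sum_gcd_eq]
    conv_lhs => rw [hfact]
    rw [(ArithmeticFunction.isMultiplicative_id.mul
        isMultiplicative_totientFunction).map_prod, Nat.cast_prod,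
      Finset.prod_congr rfl fun j _ => id_mul_totientFunction_prime_pow (hp j) (k j),
      Finset.prod_mul_distrib, hfact]
    · push_cast
      rfl
    · intro i _ j _ hij
      exact Nat.Coprime.pow _ _ ((Nat.coprime_primes (hp i) (hp j)).2 (hdist.ne hij))
  rw [defect, finrank_defectSpace_fourierMatrix, Nat.cast_sub (two_mul_sub_one_le_sum_gcd N),
    hdim, Nat.cast_sub (by omega)]
  push_cast
  ring

end
end

section
/- If N is a prime number, then the defect of the Fourier matrix F_N is zero: d(F_N) = 0. -/
open Matrix ComplexConjugate

noncomputable section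

/-- The entries of `F_N` are the values of the standard additive character, up to scaling. -/
theorem fourierMatrix_apply_eq_stdAddChar (n : ℕ) (i k : ZMod (n + 1)) :
    fourierMatrix (n + 1) i k =
      ZMod.stdAddChar (i * k) / (Real.sqrt ((n + 1 : ℕ) : ℝ) : ℝ) := by
  have h : i * k = (((i.val * k.val : ℕ) : ℤ) : ZMod (n + 1)) := by
    push_cast
    simp only [ZMod.natCast_val, ZMod.cast_id', id_eq]
  rw [h, ZMod.stdAddChar_coe]
  change Complex.exp (2 * Real.pi * Complex.I * i.val * k.val / (n + 1 : ℕ)) / _ = _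
  congr 2
  push_cast
  ring

/-- Membership in `S(F_N)` says that the Fourier coefficients of rows `i` and `j` agree at
the frequency `i - j`. -/
theorem sum_stdAddChar_eq_of_mem_defectSpace {n : ℕ}
    {R : Matrix (ZMod (n + 1)) (ZMod (n + 1)) ℝ}
    (hR : R ∈ defectSpace (fourierMatrix (n + 1))) (i j : ZMod (n + 1)) :
    ∑ k, ZMod.stdAddChar ((i - j) * k) * (R i k : ℂ) =
      ∑ k, ZMod.stdAddChar ((i - j) * k) * (R j k : ℂ) := by
  have of_lt : ∀ i j : ZMod (n + 1), LT.lt (α := Fin (n + 1)) i j →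
      ∑ k, ZMod.stdAddChar ((i - j) * k) * ((R i k : ℂ) - (R j k : ℂ)) = 0 := by
    intro i j hij
    have hs : ((Real.sqrt ((n + 1 : ℕ) : ℝ) : ℝ) : ℂ) ≠ 0 := by
      rw [Ne, Complex.ofReal_eq_zero]
      positivity
    set s : ℂ := ((Real.sqrt ((n + 1 : ℕ) : ℝ) : ℝ) : ℂ) with hs_def
    have h : ∑ k : ZMod (n + 1), fourierMatrix (n + 1) i k * conj (fourierMatrix (n + 1) j k) *
        ((R i k : ℂ) - (R j k : ℂ)) = 0 := hR i j hij
    have key : ∀ k : ZMod (n + 1),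
        ZMod.stdAddChar ((i - j) * k) *
          ((R i k : ℂ) - (R j k : ℂ)) =
        s * s * (fourierMatrix (n + 1) i k * conj (fourierMatrix (n + 1) j k) *
          ((R i k : ℂ) - (R j k : ℂ))) := by
      intro k
      rw [fourierMatrix_apply_eq_stdAddChar, fourierMatrix_apply_eq_stdAddChar, map_div₀,
        Complex.conj_ofReal, ← AddChar.map_neg_eq_conj, sub_mul, sub_eq_add_neg,
        AddChar.map_add_eq_mul, ← hs_def]
      field_simp
    rw [Finset.sum_congr rfl fun k _ => key k, ← Finset.mul_sum, h, mul_zero]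
  rcases lt_trichotomy (α := Fin (n + 1)) i j with h | h | h
  · have := of_lt i j h
    simpa only [mul_sub, Finset.sum_sub_distrib, sub_eq_zero] using this
  · rw [show i = j from h]
  · have := congrArg conj (of_lt j i h)
    simp only [map_sum, map_mul, map_sub, Complex.conj_ofReal, ← AddChar.map_neg_eq_conj,
      map_zero, ← neg_mul, neg_sub] at this
    rw [eq_comm]
    simpa only [mul_sub, Finset.sum_sub_distrib, sub_eq_zero] using this

/-- A function on `ZMod N` whose Fourier transform is supported at `0` is constant. -/
theorem ZMod.apply_eq_apply_zero_of_dft_eq_zero {N : ℕ} [NeZero N] {f : ZMod N → ℂ}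
    (hf : ∀ m, m ≠ 0 → ZMod.dft f m = 0) (k : ZMod N) : f k = f 0 := by
  have h : ∀ k, f k = (N : ℂ)⁻¹ * ZMod.dft f 0 := by
    intro k
    conv_lhs => rw [← ZMod.dft.symm_apply_apply f]
    rw [ZMod.invDFT_apply, Finset.sum_eq_single 0 (fun m _ hm => by rw [hf m hm, smul_zero])
      (by simp)]
    simp
  rw [h k, h 0]

/-- For `N` prime, every row of `R ∈ S(F_N)` differs from the first one by a constant. -/
theorem sub_eq_sub_of_mem_defectSpace {n : ℕ} (hn : (n + 1).Prime)
    {R : Matrix (ZMod (n + 1)) (ZMod (n + 1)) ℝ}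
    (hR : R ∈ defectSpace (fourierMatrix (n + 1))) (i k : ZMod (n + 1)) :
    R i k - R 0 k = R i 0 - R 0 0 := by
  have : Fact (n + 1).Prime := ⟨hn⟩
  have step (d : ZMod (n + 1)) (t : ℕ) :
      ∑ k, ZMod.stdAddChar (d * k) * (R (t * d) k : ℂ) =
        ∑ k, ZMod.stdAddChar (d * k) * (R 0 k : ℂ) := by
    induction t with
    | zero => simp
    | succ t ih =>
      rw [← ih]
      have := sum_stdAddChar_eq_of_mem_defectSpace hR ((t + 1 : ℕ) * d) (t * d)
      rwa [show ((t + 1 : ℕ) : ZMod (n + 1)) * d - t * d = d by push_cast; ring] at this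
  have rows (d : ZMod (n + 1)) (hd : d ≠ 0) :
      ∑ k, ZMod.stdAddChar (d * k) * (R i k : ℂ) =
        ∑ k, ZMod.stdAddChar (d * k) * (R 0 k : ℂ) := by
    have h := step d (i * d⁻¹).val
    rwa [ZMod.natCast_zmod_val, inv_mul_cancel_right₀ hd] at h
  have h := ZMod.apply_eq_apply_zero_of_dft_eq_zero
    (f := fun k => ((R i k - R 0 k : ℝ) : ℂ)) (fun m hm => by
      have := rows (-m) (neg_ne_zero.mpr hm)
      rw [ZMod.dft_apply]
      simp only [Complex.ofReal_sub, smul_eq_mul, mul_sub, Finset.sum_sub_distrib, sub_eq_zero]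
      simpa only [neg_mul, mul_comm m] using this) k
  exact_mod_cast h

/-- If `N` is prime then `d(F_N) = 0`. -/
theorem defect_fourier_eq_zero_of_prime (N : ℕ) (hN : N.Prime) :
    defect (fourierMatrix N) = 0 := by
  obtain ⟨n, rfl⟩ : ∃ n, N = n + 1 := ⟨N - 1, by have := hN.pos; omega⟩
  let f : Matrix (Fin (n + 1)) (Fin (n + 1)) ℝ →ₗ[ℝ] (Fin (n + 1) → ℝ) × (Fin n → ℝ) :=
    { toFun := fun R => (R 0, fun i => R i.succ 0)
      map_add' := fun _ _ => rfl
      map_smul' := fun _ _ => rfl }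
  have hf : Function.Injective (f.domRestrict (defectSpace (fourierMatrix (n + 1)))) := by
    rw [injective_iff_map_eq_zero]
    rintro ⟨R, hR⟩ h
    have h0 : R 0 = 0 := congrArg Prod.fst h
    have h1 : (fun i : Fin n => R i.succ 0) = 0 := congrArg Prod.snd h
    have hcol (i : Fin (n + 1)) : R i 0 = 0 := by
      cases i using Fin.cases with
      | zero => exact congrFun h0 0
      | succ i => exact congrFun h1 i
    refine Subtype.ext (Matrix.ext fun i k => ?_)
    have hik : R i k - R 0 k = R i 0 - R 0 0 := sub_eq_sub_of_mem_defectSpace hN hR i k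
    simpa [hcol, h0] using hik
  have hle := LinearMap.finrank_le_finrank_of_injective hf
  simp only [Module.finrank_prod, Module.finrank_fin_fun] at hle
  simp only [defect]
  omega

end
end
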